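/- Let m be a positive integer with μ(2m + k) = k. Then Kameko's homomorphism Sq̃^0_* : (QP_k)_{2m+k} → (QP_k)_m is an isomorphism of F_2-vector spaces. -/

import Mathlib

/-- `μ(n)`: the smallest `r` such that `n` can be written as a sum of `r` numbers
of the form `2^d - 1` with `d > 0`. -/
noncomputable def muNat (n : ℕ) : ℕ :=
  sInf {r : ℕ | ∃ d : Fin r → ℕ, (∀ i, 0 < d i) ∧ n = ∑ i, (2 ^ d i - 1)}

open MvPolynomial

/-- The total Steenrod square on `P_k = F_2[x_1,…,x_k]`, the algebra map with
`Sq(x_j) = x_j + x_j^2`. -/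
noncomputable def SqTotal (k : ℕ) :
    MvPolynomial (Fin k) (ZMod 2) →ₐ[ZMod 2] MvPolynomial (Fin k) (ZMod 2) :=
  aeval fun j => X j + X j ^ 2

/-- The Steenrod square `Sq^i : P_k → P_k`, sending a homogeneous polynomial `f` of
degree `d` to the degree-`d + i` homogeneous component of `Sq(f)`, extended additively. -/
noncomputable def SqOp (k i : ℕ) (f : MvPolynomial (Fin k) (ZMod 2)) :
    MvPolynomial (Fin k) (ZMod 2) :=
  ∑ d ∈ Finset.range (f.totalDegree + 1),
    homogeneousComponent (d + i) (SqTotal k (homogeneousComponent d f))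

/-- The space of hit polynomials: finite sums of `Sq^i (f_i)` with `i > 0`. -/
noncomputable def hitSubmodule (k : ℕ) :
    Submodule (ZMod 2) (MvPolynomial (Fin k) (ZMod 2)) :=
  Submodule.span (ZMod 2) {g | ∃ i f, 0 < i ∧ g = SqOp k i f}

/-- A polynomial is hit if it is a finite sum of `Sq^i (f_i)` with `i > 0`. -/
def IsHit (k : ℕ) (f : MvPolynomial (Fin k) (ZMod 2)) : Prop := f ∈ hitSubmodule k

/-- `(QP_k)_n`: the space of homogeneous polynomials of degree `n` modulo hit polynomials. -/
abbrev QP (k n : ℕ) :=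
  ↥(homogeneousSubmodule (Fin k) (ZMod 2) n) ⧸
    ((hitSubmodule k).comap (homogeneousSubmodule (Fin k) (ZMod 2) n).subtype)

/-- Kameko's map `Sq̃ : P_k → P_k`, defined on monomials by `Sq̃(x) = y` if
`x = x_1 x_2 ⋯ x_k · y^2` for a monomial `y`, and `Sq̃(x) = 0` otherwise,
extended linearly. -/
noncomputable def kamekoFun (k : ℕ) (f : MvPolynomial (Fin k) (ZMod 2)) :
    MvPolynomial (Fin k) (ZMod 2) :=
  ∑ a ∈ f.support,
    if ∀ j, Odd (a j) then
      monomial (Finsupp.mapRange (fun t => (t - 1) / 2) (by norm_num) a) (f.coeff a)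
    else 0

/-- Over `F_2`, squaring is additive on polynomials. -/
theorem add_sq_zmod_two {σ : Type*} (f g : MvPolynomial σ (ZMod 2)) :
    (f + g) ^ 2 = f ^ 2 + g ^ 2 :=
  add_pow_char f g 2

section Graded

variable {σ R : Type*} [CommSemiring R]

attribute [local instance] MvPolynomial.gradedAlgebra

theorem homogeneousComponent_mul_of_isHomogeneous {g : MvPolynomial σ R} {d : ℕ}
    (hg : g.IsHomogeneous d) (f : MvPolynomial σ R) (c : ℕ) :
    homogeneousComponent (c + d) (f * g) = homogeneousComponent c f * g := by
  have h := DirectSum.coe_decompose_mul_add_of_right_mem (homogeneousSubmodule σ R)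
    (i := c) (j := d) (a := f) (b := g) hg
  simp only [← decomposition.decompose'_apply]
  exact h

theorem homogeneousComponent_mul_of_lt {g : MvPolynomial σ R} {c d : ℕ}
    (hg : g.IsHomogeneous d) (f : MvPolynomial σ R) (h : c < d) :
    homogeneousComponent c (f * g) = 0 := by
  have h := DirectSum.coe_decompose_mul_of_right_mem_of_not_le (homogeneousSubmodule σ R)
    (i := d) (n := c) (a := f) (b := g) hg (not_le.2 h)
  rw [← decomposition.decompose'_apply]
  exact h

theorem homogeneousComponent_sq (f : MvPolynomial σ (ZMod 2)) (c : ℕ) :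
    homogeneousComponent (2 * c) (f ^ 2) = homogeneousComponent c f ^ 2 := by
  conv_lhs => rw [← sum_homogeneousComponent f]
  rw [sum_pow_char, map_sum]
  have key : ∀ i, homogeneousComponent (2 * c) (homogeneousComponent i f ^ 2) =
      if i = c then homogeneousComponent c f ^ 2 else 0 := by
    intro i
    rw [homogeneousComponent_of_mem ((homogeneousComponent_isHomogeneous i f).pow 2)]
    by_cases h : i = c
    · subst h; simp [mul_comm]
    · rw [if_neg h, if_neg (by omega)]
  simp_rw [key]
  rw [Finset.sum_ite_eq']
  split_ifs with h
  · rfl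
  · rw [homogeneousComponent_eq_zero _ _ (by simpa using h)]
    simp

theorem MvPolynomial.IsHomogeneous.induction_monomial {f : MvPolynomial σ R} {d : ℕ}
    (hf : f.IsHomogeneous d) {M : MvPolynomial σ R → Prop} (hzero : M 0)
    (hadd : ∀ p q, M p → M q → M (p + q))
    (mon : ∀ a r, f.coeff a = r → r ≠ 0 → a.degree = d → M (monomial a r)) : M f := by
  rw [f.as_sum]
  refine Finset.sum_induction _ M hadd hzero fun a ha => mon a _ rfl (mem_support_iff.1 ha) ?_
  by_contra h
  exact (mem_support_iff.1 ha) (hf.coeff_eq_zero h)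

end Graded

section Kameko

variable {k : ℕ}

/-- The exponent vector `2b + (1, …, 1)`. -/
noncomputable def oddExponent (b : Fin k →₀ ℕ) : Fin k →₀ ℕ :=
  Finsupp.equivFunOnFinite.symm fun j => 2 * b j + 1

@[simp] theorem oddExponent_apply (b : Fin k →₀ ℕ) (j : Fin k) :
    oddExponent b j = 2 * b j + 1 := rfl

theorem degree_oddExponent (b : Fin k →₀ ℕ) : (oddExponent b).degree = 2 * b.degree + k := by
  simp [Finsupp.degree_eq_sum, Finset.sum_add_distrib, Finset.mul_sum]

theorem coeff_kamekoFun (f : MvPolynomial (Fin k) (ZMod 2)) (b : Fin k →₀ ℕ) :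
    coeff b (kamekoFun k f) = coeff (oddExponent b) f := by
  classical
  unfold kamekoFun
  rw [coeff_sum]
  have key : ∀ a : Fin k →₀ ℕ, coeff b (if ∀ j, Odd (a j) then
      monomial (Finsupp.mapRange (fun t => (t - 1) / 2) (by norm_num) a) (f.coeff a) else 0) =
      if a = oddExponent b then f.coeff (oddExponent b) else 0 := by
    intro a
    by_cases h : a = oddExponent b
    · subst h
      rw [if_pos rfl, if_pos (fun j => by simp), coeff_monomial, if_pos]
      ext j; simp
    · rw [if_neg h]
      split_ifs with ho
      · rw [coeff_monomial, if_neg]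
        rintro rfl
        refine h (Finsupp.ext fun j => ?_)
        obtain ⟨t, ht⟩ := ho j
        simp [ht]
      · simp
  simp_rw [key]
  rw [Finset.sum_ite_eq']
  split_ifs with h
  · rfl
  · exact (notMem_support_iff.1 h).symm

/-- Kameko's map as a linear map. -/
noncomputable def kamekoLinear (k : ℕ) :
    MvPolynomial (Fin k) (ZMod 2) →ₗ[ZMod 2] MvPolynomial (Fin k) (ZMod 2) where
  toFun := kamekoFun k
  map_add' f g := by ext b; simp [coeff_kamekoFun]
  map_smul' c f := by ext b; simp [coeff_kamekoFun]

@[simp] theorem coeff_kamekoLinear (f : MvPolynomial (Fin k) (ZMod 2)) (b : Fin k →₀ ℕ) :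
    coeff b (kamekoLinear k f) = coeff (oddExponent b) f := coeff_kamekoFun f b

theorem kamekoLinear_homogeneousComponent (f : MvPolynomial (Fin k) (ZMod 2)) (m : ℕ) :
    kamekoLinear k (homogeneousComponent (2 * m + k) f) =
      homogeneousComponent m (kamekoLinear k f) := by
  ext b
  rw [coeff_kamekoLinear, coeff_homogeneousComponent, coeff_homogeneousComponent,
    coeff_kamekoLinear, degree_oddExponent]
  congr 1
  simp

theorem kamekoLinear_isHomogeneous {f : MvPolynomial (Fin k) (ZMod 2)} {m : ℕ}
    (hf : f.IsHomogeneous (2 * m + k)) : (kamekoLinear k f).IsHomogeneous m := by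
  rw [← homogeneousComponent_eq_self hf, kamekoLinear_homogeneousComponent]
  exact homogeneousComponent_isHomogeneous _ _

theorem kamekoLinear_eq_zero {f : MvPolynomial (Fin k) (ZMod 2)} {n : ℕ}
    (hf : f.IsHomogeneous n) (hn : ∀ m, n ≠ 2 * m + k) : kamekoLinear k f = 0 := by
  ext b
  rw [coeff_kamekoLinear, coeff_zero]
  refine hf.coeff_eq_zero fun h => hn b.degree ?_
  rw [← h, degree_oddExponent]

theorem kamekoLinear_mul_sq (f w : MvPolynomial (Fin k) (ZMod 2)) :
    kamekoLinear k (f * w ^ 2) = kamekoLinear k f * w := by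
  induction w using MvPolynomial.induction_on' with
  | monomial b c =>
    ext m
    rw [monomial_pow, coeff_kamekoLinear, coeff_mul_monomial', coeff_mul_monomial',
      ZMod.pow_card c]
    have hle : 2 • b ≤ oddExponent m ↔ b ≤ m := by
      simp only [Finsupp.le_def, Finsupp.smul_apply, oddExponent_apply, smul_eq_mul]
      exact forall_congr' fun j => by omega
    simp only [hle, coeff_kamekoLinear]
    split_ifs with h
    · congr 2
      ext j
      have := h j
      simp only [Finsupp.tsub_apply, Finsupp.smul_apply, oddExponent_apply, smul_eq_mul]
      omega
    · rfl
  | add p q hp hq => rw [add_sq_zmod_two, mul_add, map_add, hp, hq, mul_add]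

theorem kamekoLinear_prod_X (S : Finset (Fin k)) :
    kamekoLinear k (∏ j ∈ S, X j) = if S = Finset.univ then 1 else 0 := by
  classical
  have hS : (∏ j ∈ S, X j : MvPolynomial (Fin k) (ZMod 2)) =
      monomial (∑ j ∈ S, Finsupp.single j 1) 1 := by
    rw [monomial_sum_one]; rfl
  have happ : ∀ i, (∑ j ∈ S, Finsupp.single j 1 : Fin k →₀ ℕ) i = if i ∈ S then 1 else 0 := by
    intro i
    simp [Finsupp.finsetSum_apply, Finsupp.single_apply]
  ext b
  rw [coeff_kamekoLinear, hS, coeff_monomial]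
  split_ifs with h1 h2 h2
  · have : b = 0 := by
      ext j
      have := DFunLike.congr_fun h1 j
      rw [happ, h2] at this
      simpa using this
    simp [this]
  · refine absurd (Finset.eq_univ_iff_forall.2 fun j => ?_) h2
    have := DFunLike.congr_fun h1 j
    rw [happ, oddExponent_apply] at this
    by_contra hj
    simp [hj] at this
  · rw [coeff_one, if_neg]
    rintro rfl
    refine h1 (Finsupp.ext fun j => ?_)
    rw [happ, h2]; simp
  · simp

theorem kamekoLinear_prod_X_add_sq (S : Finset (Fin k))
    (z : Fin k → MvPolynomial (Fin k) (ZMod 2)) :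
    kamekoLinear k (∏ j ∈ S, (X j + z j ^ 2)) = if S = Finset.univ then 1 else 0 := by
  classical
  rw [Finset.prod_add, map_sum]
  simp_rw [Finset.prod_pow, kamekoLinear_mul_sq, kamekoLinear_prod_X]
  split_ifs with h
  · subst h
    rw [Finset.sum_eq_single Finset.univ]
    · simp
    · intro T _ hT; simp [hT]
    · simp
  · refine Finset.sum_eq_zero fun T hT => ?_
    rw [if_neg, zero_mul]
    rintro rfl
    exact h (Finset.univ_subset_iff.1 (Finset.mem_powerset.1 hT))

/-- Every monomial is a squarefree monomial times a square. -/
theorem exists_monomial_eq_prod_X_mul_sq (a : Fin k →₀ ℕ) :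
    ∃ (S : Finset (Fin k)) (b : Fin k →₀ ℕ), a.degree = S.card + 2 * b.degree ∧
      (S = Finset.univ → a = oddExponent b) ∧
      (monomial a 1 : MvPolynomial (Fin k) (ZMod 2)) = (∏ j ∈ S, X j) * monomial b 1 ^ 2 := by
  classical
  refine ⟨Finset.univ.filter fun j => Odd (a j), a.mapRange (· / 2) rfl, ?_, ?_, ?_⟩
  · rw [Finsupp.degree_eq_sum, Finsupp.degree_eq_sum, Finset.card_filter, Finset.mul_sum,
      ← Finset.sum_add_distrib]
    refine Finset.sum_congr rfl fun j _ => ?_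
    simp only [Finsupp.mapRange_apply, Nat.odd_iff]
    split_ifs <;> omega
  · intro h
    ext j
    have := Nat.odd_iff.1 (Finset.filter_eq_self.1 h j (Finset.mem_univ j))
    simp only [oddExponent_apply, Finsupp.mapRange_apply]
    omega
  · have hS : (∏ j ∈ Finset.univ.filter fun j => Odd (a j), X j :
        MvPolynomial (Fin k) (ZMod 2)) =
        monomial (∑ j ∈ Finset.univ.filter fun j => Odd (a j), Finsupp.single j 1) 1 := by
      rw [monomial_sum_one]; rfl
    rw [hS, monomial_pow, monomial_mul, one_pow, one_mul]
    congr 2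
    ext i
    simp only [Finsupp.add_apply, Finsupp.finsetSum_apply, Finsupp.single_apply,
      Finset.sum_ite_eq', Finset.mem_filter, Finset.mem_univ, true_and, Finsupp.smul_apply,
      Finsupp.mapRange_apply, smul_eq_mul, Nat.odd_iff]
    split_ifs <;> omega

end Kameko

section Steenrod

variable {k : ℕ}

theorem SqTotal_X (j : Fin k) : SqTotal k (X j) = X j + X j ^ 2 := by
  simp [SqTotal]

/-- The total square commutes with Kameko's map. -/
theorem kamekoLinear_SqTotal (f : MvPolynomial (Fin k) (ZMod 2)) :
    kamekoLinear k (SqTotal k f) = SqTotal k (kamekoLinear k f) := by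
  induction f using MvPolynomial.induction_on' with
  | monomial a c =>
    obtain ⟨S, b, -, -, h⟩ := exists_monomial_eq_prod_X_mul_sq a
    have hc : (monomial a c : MvPolynomial (Fin k) (ZMod 2)) = c • monomial a 1 := by
      rw [smul_monomial, smul_eq_mul, mul_one]
    rw [hc, h]
    simp only [map_smul, map_mul, map_prod, map_pow, SqTotal_X, kamekoLinear_mul_sq,
      kamekoLinear_prod_X_add_sq, kamekoLinear_prod_X]
    split_ifs <;> simp
  | add p q hp hq => simp only [map_add, hp, hq]

/-- The bounds on the degrees occurring in `Sq(y)`, for `y` a monomial, together with the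
extreme terms `Sq^0(y) = y` and `Sq^d(y) = y^2`. -/
theorem exists_homogeneousComponent_SqTotal_monomial (a : Fin k →₀ ℕ) (r : ZMod 2) :
    ∃ d, (monomial a r).IsHomogeneous d ∧
      (∀ c < d, homogeneousComponent c (SqTotal k (monomial a r)) = 0) ∧
      (∀ c, 2 * d < c → homogeneousComponent c (SqTotal k (monomial a r)) = 0) ∧
      homogeneousComponent d (SqTotal k (monomial a r)) = monomial a r ∧
      homogeneousComponent (2 * d) (SqTotal k (monomial a r)) = monomial a r ^ 2 := by
  refine induction_on_monomial (motive := fun p => ∃ d, p.IsHomogeneous d ∧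
      (∀ c < d, homogeneousComponent c (SqTotal k p) = 0) ∧
      (∀ c, 2 * d < c → homogeneousComponent c (SqTotal k p) = 0) ∧
      homogeneousComponent d (SqTotal k p) = p ∧
      homogeneousComponent (2 * d) (SqTotal k p) = p ^ 2) (fun r => ?_) (fun p j ih => ?_) a r
  · have hr : SqTotal k (C r) = C r := (SqTotal k).commutes r
    have h0 : homogeneousComponent 0 (C r : MvPolynomial (Fin k) (ZMod 2)) = C r := by
      simp
    refine ⟨0, isHomogeneous_C _ _, by simp, fun c hc => ?_, by rw [hr, h0], ?_⟩
    · rw [hr, homogeneousComponent_eq_zero]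
      simpa using hc
    · rw [hr, mul_zero, h0, ← C_pow, ZMod.pow_card r]
  · obtain ⟨d, hd, hlow, hhigh, hbot, htop⟩ := ih
    have hX : (X j : MvPolynomial (Fin k) (ZMod 2)).IsHomogeneous 1 := isHomogeneous_X _ j
    have hX2 : (X j ^ 2 : MvPolynomial (Fin k) (ZMod 2)).IsHomogeneous 2 :=
      isHomogeneous_X_pow j 2
    have hcomp : ∀ c, homogeneousComponent (c + 2) (SqTotal k (p * X j)) =
        homogeneousComponent (c + 1) (SqTotal k p) * X j +
        homogeneousComponent c (SqTotal k p) * X j ^ 2 := by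
      intro c
      rw [map_mul, SqTotal_X, mul_add, map_add, homogeneousComponent_mul_of_isHomogeneous hX2,
        ← homogeneousComponent_mul_of_isHomogeneous hX]
    have hcomp1 : homogeneousComponent 1 (SqTotal k (p * X j)) =
        homogeneousComponent 0 (SqTotal k p) * X j := by
      rw [map_mul, SqTotal_X, mul_add, map_add, homogeneousComponent_mul_of_lt hX2 _ one_lt_two,
        ← homogeneousComponent_mul_of_isHomogeneous hX, add_zero, zero_add]
    have hcomp0 : homogeneousComponent 0 (SqTotal k (p * X j)) = 0 := by
      rw [map_mul, SqTotal_X, mul_add, map_add, homogeneousComponent_mul_of_lt hX2 _ two_pos,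
        homogeneousComponent_mul_of_lt hX _ one_pos, add_zero]
    refine ⟨d + 1, hd.mul hX, fun c hc => ?_, fun c hc => ?_, ?_, ?_⟩
    · match c with
      | 0 => exact hcomp0
      | 1 => rw [hcomp1, hlow 0 (by omega), zero_mul]
      | c + 2 => rw [hcomp, hlow _ (by omega), hlow _ (by omega), zero_mul, zero_mul, add_zero]
    · obtain ⟨c, rfl⟩ : ∃ c', c = c' + 2 := ⟨c - 2, by omega⟩
      rw [hcomp, hhigh _ (by omega), hhigh _ (by omega), zero_mul, zero_mul, add_zero]
    · match d with
      | 0 => rw [zero_add, hcomp1, hbot]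
      | d + 1 => rw [hcomp, hbot, hlow _ (by omega), zero_mul, add_zero]
    · rw [mul_add, mul_one, hcomp, htop, hhigh _ (by omega), zero_mul, zero_add, mul_pow]

theorem homogeneousComponent_SqTotal_monomial_top (a : Fin k →₀ ℕ) :
    homogeneousComponent (2 * a.degree) (SqTotal k (monomial a 1)) = monomial a 1 ^ 2 := by
  obtain ⟨d, hd, -, -, -, h⟩ := exists_homogeneousComponent_SqTotal_monomial a 1
  rwa [(isHomogeneous_monomial (1 : ZMod 2) rfl).inj_right hd (by simp)]

theorem homogeneousComponent_SqTotal_of_lt {f : MvPolynomial (Fin k) (ZMod 2)} {c d : ℕ}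
    (hf : f.IsHomogeneous d) (hc : c < d) : homogeneousComponent c (SqTotal k f) = 0 := by
  refine hf.induction_monomial (M := fun f => homogeneousComponent c (SqTotal k f) = 0)
    (by simp) (fun p q hp hq => by rw [map_add, map_add, hp, hq, add_zero])
    fun a r _ hr ha => ?_
  obtain ⟨d', hd', h, -⟩ := exists_homogeneousComponent_SqTotal_monomial a r
  rw [← (isHomogeneous_monomial r ha).inj_right hd' (by simpa using hr)] at h
  exact h c hc

theorem homogeneousComponent_SqTotal_self {f : MvPolynomial (Fin k) (ZMod 2)} {d : ℕ}
    (hf : f.IsHomogeneous d) : homogeneousComponent d (SqTotal k f) = f := by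
  refine hf.induction_monomial (M := fun f => homogeneousComponent d (SqTotal k f) = f)
    (by simp) (fun p q hp hq => by rw [map_add, map_add, hp, hq])
    fun a r _ hr ha => ?_
  obtain ⟨d', hd', -, -, h, -⟩ := exists_homogeneousComponent_SqTotal_monomial a r
  rwa [← (isHomogeneous_monomial r ha).inj_right hd' (by simpa using hr)] at h

theorem homogeneousComponent_SqTotal_mem_hitSubmodule {f : MvPolynomial (Fin k) (ZMod 2)}
    {d i : ℕ} (hf : f.IsHomogeneous d) (hi : 0 < i) :
    homogeneousComponent (d + i) (SqTotal k f) ∈ hitSubmodule k := by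
  by_cases h0 : f = 0
  · simp [h0]
  refine Submodule.subset_span ⟨i, f, hi, ?_⟩
  rw [SqOp, hf.totalDegree h0, Finset.sum_eq_single d]
  · rw [homogeneousComponent_eq_self hf]
  · intro c _ hc
    rw [homogeneousComponent_of_mem hf, if_neg hc, map_zero, map_zero]
  · simp

/-- To prove a property of all hit polynomials that is stable under addition, it suffices to treat
the images of homogeneous polynomials under the positive Steenrod squares. -/
theorem hitSubmodule_induction {M : MvPolynomial (Fin k) (ZMod 2) → Prop} (hzero : M 0)
    (hadd : ∀ p q, M p → M q → M (p + q))
    (comp : ∀ f d i, f.IsHomogeneous d → 0 < i →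
      M (homogeneousComponent (d + i) (SqTotal k f)))
    {p : MvPolynomial (Fin k) (ZMod 2)} (hp : p ∈ hitSubmodule k) : M p := by
  refine Submodule.span_induction ?_ hzero (fun p q _ _ => hadd p q) (fun c p _ h => ?_) hp
  · rintro _ ⟨i, f, hi, rfl⟩
    exact Finset.sum_induction _ M hadd hzero
      fun d _ => comp _ d i (homogeneousComponent_isHomogeneous d f) hi
  · fin_cases c
    · exact (zero_smul (ZMod 2) p).symm ▸ hzero
    · exact (one_smul (ZMod 2) p).symm ▸ h

theorem homogeneousComponent_SqTotal_sub_mem (w : MvPolynomial (Fin k) (ZMod 2)) (n : ℕ) :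
    homogeneousComponent n (SqTotal k w) - homogeneousComponent n w ∈ hitSubmodule k := by
  conv => enter [2]; rw [← sum_homogeneousComponent w]
  simp only [map_sum, ← Finset.sum_sub_distrib]
  refine Submodule.sum_mem _ fun c _ => ?_
  have hc := homogeneousComponent_isHomogeneous c w
  rw [homogeneousComponent_of_mem hc]
  rcases lt_trichotomy n c with h | rfl | h
  · rw [homogeneousComponent_SqTotal_of_lt hc h, if_neg h.ne, sub_zero]
    exact zero_mem _
  · rw [homogeneousComponent_SqTotal_self hc, if_pos rfl, sub_self]
    exact zero_mem _
  · obtain ⟨i, rfl⟩ := Nat.exists_eq_add_of_lt h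
    rw [if_neg h.ne', sub_zero, add_assoc]
    exact homogeneousComponent_SqTotal_mem_hitSubmodule hc (by omega)

/-- A truncation of the conjugate total square, `x_j ↦ ∑_{i < N} x_j^{2^i}`. -/
noncomputable def conjSq (k N : ℕ) :
    MvPolynomial (Fin k) (ZMod 2) →ₐ[ZMod 2] MvPolynomial (Fin k) (ZMod 2) :=
  aeval fun j => ∑ i ∈ Finset.range N, X j ^ 2 ^ i

theorem conjSq_X (N : ℕ) (j : Fin k) :
    conjSq k N (X j) = ∑ i ∈ Finset.range N, X j ^ 2 ^ i := by
  simp [conjSq]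

theorem SqTotal_conjSq_X (N : ℕ) (j : Fin k) :
    SqTotal k (conjSq k N (X j)) = X j + X j ^ 2 ^ N := by
  rw [conjSq_X, map_sum]
  induction N with
  | zero => simp [CharTwo.add_self_eq_zero]
  | succ N ih =>
    rw [Finset.sum_range_succ, ih, map_pow, SqTotal_X, add_pow_char_pow, ← pow_mul, ← pow_succ']
    rw [add_assoc, ← add_assoc (X j ^ 2 ^ N), CharTwo.add_self_eq_zero, zero_add]

theorem homogeneousComponent_SqTotal_conjSq_mul (u v : MvPolynomial (Fin k) (ZMod 2)) {n N : ℕ}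
    (hN : n < 2 ^ N) :
    homogeneousComponent n (SqTotal k (conjSq k N u) * v) = homogeneousComponent n (u * v) := by
  set J : Ideal (MvPolynomial (Fin k) (ZMod 2)) :=
    Ideal.span (Set.range fun j => X j ^ 2 ^ N) with hJ
  have hom : ((Ideal.Quotient.mkₐ (ZMod 2) J).comp ((SqTotal k).comp (conjSq k N))) =
      Ideal.Quotient.mkₐ (ZMod 2) J := by
    refine MvPolynomial.algHom_ext fun j => ?_
    simp only [AlgHom.comp_apply, SqTotal_conjSq_X, Ideal.Quotient.mkₐ_eq_mk]
    rw [Ideal.Quotient.eq, add_sub_cancel_left]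
    exact Ideal.subset_span ⟨j, rfl⟩
  have hu : SqTotal k (conjSq k N u) - u ∈ J := by
    rw [← Ideal.Quotient.eq]
    exact DFunLike.congr_fun hom u
  rw [← sub_eq_zero, ← map_sub, ← sub_mul]
  obtain ⟨c, hc⟩ := Ideal.mem_span_range_iff_exists_fun.1 (J.mul_mem_right v hu)
  rw [← hc, map_sum]
  exact Finset.sum_eq_zero fun j _ =>
    homogeneousComponent_mul_of_lt (isHomogeneous_X_pow j _) _ hN

/-- The `χ`-trick: modulo hit polynomials, Steenrod operations may be moved from one factor to the
other at the cost of conjugation. -/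
theorem homogeneousComponent_mul_SqTotal_sub_mem (u v : MvPolynomial (Fin k) (ZMod 2)) {n N : ℕ}
    (hN : n < 2 ^ N) :
    homogeneousComponent n (u * SqTotal k v) - homogeneousComponent n (conjSq k N u * v) ∈
      hitSubmodule k := by
  rw [← homogeneousComponent_SqTotal_conjSq_mul u _ hN, ← map_mul]
  exact homogeneousComponent_SqTotal_sub_mem _ n

theorem homogeneousComponent_conjSq_prod_X_eq_zero (S : Finset (Fin k)) (N c : ℕ)
    (hc : ∀ e : Fin k → ℕ, c ≠ ∑ j ∈ S, 2 ^ e j) :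
    homogeneousComponent c (conjSq k N (∏ j ∈ S, X j)) = 0 := by
  classical
  rw [map_prod]
  simp_rw [conjSq_X]
  rw [Finset.prod_sum, map_sum]
  refine Finset.sum_eq_zero fun p _ => ?_
  have hhom := IsHomogeneous.prod S.attach
    (fun x => (X x.1 ^ 2 ^ p x.1 x.2 : MvPolynomial (Fin k) (ZMod 2)))
    (fun x => 2 ^ p x.1 x.2) (fun x _ => isHomogeneous_X_pow x.1 _)
  rw [homogeneousComponent_of_mem hhom, if_neg]
  refine fun h => hc (fun j => if h : j ∈ S then p j h else 0) ?_
  rw [h, ← Finset.sum_attach S]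
  exact Finset.sum_congr rfl fun x _ => by simp

/-- A monomial `x_{j_1} ⋯ x_{j_s} y^2` of degree `n` with `s < μ(n)` is hit. -/
theorem prod_X_mul_sq_mem_hitSubmodule (S : Finset (Fin k)) (b : Fin k →₀ ℕ)
    (h : S.card < muNat (S.card + 2 * b.degree)) :
    (∏ j ∈ S, X j) * monomial b 1 ^ 2 ∈ hitSubmodule k := by
  set u : MvPolynomial (Fin k) (ZMod 2) := ∏ j ∈ S, X j with hu
  have huhom : u.IsHomogeneous S.card := by
    simpa using IsHomogeneous.prod S (fun j => (X j : MvPolynomial (Fin k) (ZMod 2)))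
      (fun _ => 1) (fun j _ => isHomogeneous_X _ j)
  have hb : (monomial b (1 : ZMod 2)).IsHomogeneous b.degree := isHomogeneous_monomial _ rfl
  have key := homogeneousComponent_mul_SqTotal_sub_mem u (monomial b 1)
    (Nat.lt_two_pow_self (n := 2 * b.degree + S.card))
  have h1 : homogeneousComponent (2 * b.degree + S.card) (u * SqTotal k (monomial b 1)) =
      u * monomial b 1 ^ 2 := by
    rw [mul_comm u, homogeneousComponent_mul_of_isHomogeneous huhom,
      homogeneousComponent_SqTotal_monomial_top, mul_comm]
  have h2 : homogeneousComponent (2 * b.degree + S.card)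
      (conjSq k (2 * b.degree + S.card) u * monomial b 1) = 0 := by
    rw [show 2 * b.degree + S.card = (S.card + b.degree) + b.degree by ring,
      homogeneousComponent_mul_of_isHomogeneous hb,
      homogeneousComponent_conjSq_prod_X_eq_zero, zero_mul]
    intro e he
    refine absurd h (not_lt.2 (Nat.sInf_le ⟨fun i => e (S.equivFin.symm i) + 1, by simp, ?_⟩))
    have hsum : ∑ i : Fin S.card, (2 ^ (e (S.equivFin.symm i) + 1) - 1) =
        ∑ j ∈ S, (2 ^ (e j + 1) - 1) := by
      rw [Equiv.sum_comp S.equivFin.symm (fun j : S => 2 ^ (e j + 1) - 1)]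
      exact Finset.sum_coe_sort S fun j => 2 ^ (e j + 1) - 1
    have hadd : ∑ j ∈ S, (2 ^ (e j + 1) - 1) + S.card = 2 * ∑ j ∈ S, 2 ^ e j := by
      rw [Finset.card_eq_sum_ones, ← Finset.sum_add_distrib, Finset.mul_sum]
      refine Finset.sum_congr rfl fun j _ => ?_
      rw [Nat.sub_add_cancel Nat.one_le_two_pow, pow_succ']
    rw [hsum]
    omega
  rwa [h1, h2, sub_zero] at key

theorem mem_hitSubmodule_of_kamekoLinear_eq_zero {f : MvPolynomial (Fin k) (ZMod 2)} {n : ℕ}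
    (hf : f.IsHomogeneous n) (hn : muNat n = k) (h0 : kamekoLinear k f = 0) :
    f ∈ hitSubmodule k := by
  refine hf.induction_monomial (M := fun p => p ∈ hitSubmodule k) (zero_mem _)
    (fun p q => add_mem) fun a r har hr ha => ?_
  obtain ⟨S, b, hdeg, huniv, heq⟩ := exists_monomial_eq_prod_X_mul_sq a
  have hS : S ≠ Finset.univ := by
    intro hS
    refine hr ?_
    rw [← har, huniv hS, ← coeff_kamekoLinear, h0, coeff_zero]
  have hcard : S.card < k := by
    simpa using Finset.card_lt_card (Finset.ssubset_univ_iff.2 hS)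
  have hmem := prod_X_mul_sq_mem_hitSubmodule S b (by rwa [← hdeg, ha, hn])
  rw [← heq] at hmem
  have hr' : (monomial a r : MvPolynomial (Fin k) (ZMod 2)) = r • monomial a 1 := by
    rw [smul_monomial, smul_eq_mul, mul_one]
  rw [hr']
  exact Submodule.smul_mem _ _ hmem

theorem kamekoLinear_mem_hitSubmodule {f : MvPolynomial (Fin k) (ZMod 2)}
    (hf : f ∈ hitSubmodule k) : kamekoLinear k f ∈ hitSubmodule k := by
  refine hitSubmodule_induction (M := fun p => kamekoLinear k p ∈ hitSubmodule k) (by simp)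
    (fun p q hp hq => by rw [map_add]; exact add_mem hp hq) (fun f d i hf hi => ?_) hf
  by_cases hdi : ∃ c, d + i = 2 * c + k
  · obtain ⟨c, hc⟩ := hdi
    rw [hc, kamekoLinear_homogeneousComponent, kamekoLinear_SqTotal]
    by_cases hd : ∃ c', d = 2 * c' + k
    · obtain ⟨c', rfl⟩ := hd
      obtain ⟨i', rfl⟩ : ∃ i', c = c' + i' := ⟨c - c', by omega⟩
      exact homogeneousComponent_SqTotal_mem_hitSubmodule (kamekoLinear_isHomogeneous hf)
        (by omega)
    · push Not at hd
      rw [kamekoLinear_eq_zero hf hd]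
      simp
  · push Not at hdi
    rw [kamekoLinear_eq_zero (homogeneousComponent_isHomogeneous _ _) hdi]
    exact zero_mem _

theorem isHomogeneous_prod_univ_X_mul_sq {p : MvPolynomial (Fin k) (ZMod 2)} {m : ℕ}
    (hp : p.IsHomogeneous m) : ((∏ j, X j) * p ^ 2).IsHomogeneous (2 * m + k) := by
  have hu : (∏ j, X j : MvPolynomial (Fin k) (ZMod 2)).IsHomogeneous k := by
    simpa using IsHomogeneous.prod Finset.univ
      (fun j => (X j : MvPolynomial (Fin k) (ZMod 2))) (fun _ => 1) (fun j _ => isHomogeneous_X _ j)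
  have := hu.mul (hp.pow 2)
  rwa [add_comm k, mul_comm m] at this

theorem kamekoLinear_prod_univ_X_mul_sq (p : MvPolynomial (Fin k) (ZMod 2)) :
    kamekoLinear k ((∏ j, X j) * p ^ 2) = p := by
  rw [kamekoLinear_mul_sq, kamekoLinear_prod_X, if_pos rfl, one_mul]

/-- When `μ(2m + k) = k`, the map `y ↦ x_1 ⋯ x_k y^2` sends hit polynomials of degree `m` to hit
polynomials. -/
theorem prod_univ_X_mul_sq_mem_hitSubmodule {m : ℕ} (h : muNat (2 * m + k) = k)
    {p : MvPolynomial (Fin k) (ZMod 2)} (hp : p.IsHomogeneous m) (hit : p ∈ hitSubmodule k) :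
    (∏ j, X j) * p ^ 2 ∈ hitSubmodule k := by
  rw [← homogeneousComponent_eq_self hp]
  refine hitSubmodule_induction
    (M := fun p => (∏ j, X j) * homogeneousComponent m p ^ 2 ∈ hitSubmodule k)
    (by simp) (fun p q hp hq => ?_) (fun g d i hg hi => ?_) hit
  · rw [map_add, add_sq_zmod_two, mul_add]
    exact add_mem hp hq
  by_cases hdi : m = d + i
  swap
  · rw [homogeneousComponent_of_mem (homogeneousComponent_isHomogeneous _ _), if_neg hdi]
    simp
  rw [homogeneousComponent_of_mem (homogeneousComponent_isHomogeneous _ _), if_pos hdi, ← hdi]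
  have hu : (∏ j, X j : MvPolynomial (Fin k) (ZMod 2)).IsHomogeneous k := by
    simpa using isHomogeneous_prod_univ_X_mul_sq (isHomogeneous_one (Fin k) (ZMod 2))
  have key := homogeneousComponent_mul_SqTotal_sub_mem (∏ j, X j) (g ^ 2)
    (Nat.lt_two_pow_self (n := 2 * m + k))
  rw [mul_comm (∏ j, X j) (SqTotal k _), homogeneousComponent_mul_of_isHomogeneous hu, map_pow,
    homogeneousComponent_sq, mul_comm _ (∏ j, X j)] at key
  refine (Submodule.sub_mem_iff_left _ ?_).1 key
  refine mem_hitSubmodule_of_kamekoLinear_eq_zero (homogeneousComponent_isHomogeneous _ _) h ?_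
  have hconj : conjSq k (2 * m + k) (∏ j, X j) =
      ∏ j, (X j + (∑ i ∈ Finset.range (2 * m + k - 1), X j ^ 2 ^ i) ^ 2) := by
    rw [map_prod]
    refine Finset.prod_congr rfl fun j _ => ?_
    rw [conjSq_X, show 2 * m + k = (2 * m + k - 1) + 1 by omega, Finset.sum_range_succ',
      sum_pow_char, add_comm]
    simp only [← pow_mul, ← pow_succ, pow_zero, pow_one, Nat.add_sub_cancel]
  rw [kamekoLinear_homogeneousComponent, kamekoLinear_mul_sq, hconj, kamekoLinear_prod_X_add_sq,
    if_pos rfl, one_mul, homogeneousComponent_of_mem hg, if_neg (by omega)]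

end Steenrod

/-- Kameko's theorem: if `m > 0` and `μ(2m + k) = k`, then Kameko's homomorphism
`Sq̃^0_* : (QP_k)_{2m+k} → (QP_k)_m` is an isomorphism of `F_2`-vector spaces. -/
theorem stmt4 (k m : ℕ) (hm : 0 < m) (h : muNat (2 * m + k) = k) :
    ∃ e : QP k (2 * m + k) ≃ₗ[ZMod 2] QP k m,
      ∀ (f : homogeneousSubmodule (Fin k) (ZMod 2) (2 * m + k))
        (g : homogeneousSubmodule (Fin k) (ZMod 2) m),
        (g : MvPolynomial (Fin k) (ZMod 2)) =
            kamekoFun k (f : MvPolynomial (Fin k) (ZMod 2)) →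
        e (Submodule.Quotient.mk f) = Submodule.Quotient.mk g := by
  let K : homogeneousSubmodule (Fin k) (ZMod 2) (2 * m + k) →ₗ[ZMod 2]
      homogeneousSubmodule (Fin k) (ZMod 2) m :=
    (kamekoLinear k).restrict fun _ hf => kamekoLinear_isHomogeneous hf
  have hK : (hitSubmodule k).comap (homogeneousSubmodule (Fin k) (ZMod 2) (2 * m + k)).subtype ≤
      ((hitSubmodule k).comap (homogeneousSubmodule (Fin k) (ZMod 2) m).subtype).comap K :=
    fun _ hf => kamekoLinear_mem_hitSubmodule hf
  have hbij : Function.Bijective (Submodule.mapQ _ _ K hK) := by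
    constructor
    · rw [← LinearMap.ker_eq_bot, LinearMap.ker_eq_bot']
      intro q hq
      obtain ⟨f, rfl⟩ := Submodule.Quotient.mk_surjective _ q
      rw [Submodule.mapQ_apply, Submodule.Quotient.mk_eq_zero] at hq
      rw [Submodule.Quotient.mk_eq_zero]
      have hKf := kamekoLinear_isHomogeneous f.2
      have hsq := prod_univ_X_mul_sq_mem_hitSubmodule h hKf hq
      refine (Submodule.sub_mem_iff_left _ hsq).1 (mem_hitSubmodule_of_kamekoLinear_eq_zero
        (f.2.sub (isHomogeneous_prod_univ_X_mul_sq hKf)) h ?_)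
      rw [map_sub, kamekoLinear_prod_univ_X_mul_sq]
      exact sub_self _
    · intro q
      obtain ⟨g, rfl⟩ := Submodule.Quotient.mk_surjective _ q
      refine ⟨Submodule.Quotient.mk ⟨_, isHomogeneous_prod_univ_X_mul_sq g.2⟩, ?_⟩
      rw [Submodule.mapQ_apply]
      congr 1
      exact Subtype.ext (kamekoLinear_prod_univ_X_mul_sq _)
  refine ⟨LinearEquiv.ofBijective _ hbij, fun f g hg => ?_⟩
  rw [LinearEquiv.ofBijective_apply, Submodule.mapQ_apply]
  congr 1
  exact Subtype.ext hg.symm
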